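/- arXiv:0811.1374 — 2 statements merged into one kernel-verified Lean document; each statement's English description precedes it below -/
import Mathlib

section
/- In the multivariate orthogonal polynomial setting below, write t_k = Σ_j c_{k,j} y_j with c_{k,j} = ∫_Ω t_k y_j dμ. Then for all admissible k and ℓ, A_k c_{k+1,ℓ} = Σ_{m : D_ℓ−1 ≤ D_m ≤ D_ℓ+1} r_{ℓ,m}(f_k) c_{p(k),m} + Σ_{j : D_{k+1}−2 ≤ D_j ≤ D_k} s_{k,j} c_{j,ℓ}, where f_k, A_k, s_{k,j} are as in the recurrence f_k t_{p(k)} = A_k t_{k+1} − Σ_{D_{k+1}−2 ≤ D_j ≤ D_k} s_{k,j} t_j, and r_{ℓ,m}(f_k) = ∫_Ω f_k y_ℓ y_m dμ are the coefficients in f_k y_ℓ = Σ_{D_ℓ−1 ≤ D_m ≤ D_ℓ+1} r_{ℓ,m}(f_k) y_m. -/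
noncomputable section

open MeasureTheory Finset

namespace SD

/-- Euclidean space `ℝ^(q+1)`. -/
abbrev Euc (q : ℕ) := EuclideanSpace ℝ (Fin (q + 1))

/-- The unit sphere `S^q ⊂ ℝ^(q+1)`, as a type. -/
abbrev Sph (q : ℕ) : Type := Metric.sphere (0 : Euc q) 1

/-- Dot product of two points of the sphere. -/
def dot {q : ℕ} (x y : Sph q) : ℝ := ∑ i, (x : Euc q) i * (y : Euc q) i

/-- Geodesic distance `arccos (x ⬝ y)` on the sphere. -/
def gdist {q : ℕ} (x y : Sph q) : ℝ := Real.arccos (dot x y)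

/-- The mesh norm `δ_C(S^q)` of a finite set of points. -/
def meshNorm {q : ℕ} (C : Finset (Sph q)) : ℝ :=
  ⨆ x : Sph q, sInf ((fun ξ => gdist x ξ) '' (C : Set (Sph q)))

/-- `f : S^q → ℝ` belongs to `Π_n^q` : it is the restriction to the sphere of an algebraic
polynomial in `q+1` variables of total degree at most `n`. -/
def InPi (q n : ℕ) (f : Sph q → ℝ) : Prop :=
  ∃ P : MvPolynomial (Fin (q + 1)) ℝ, P.totalDegree ≤ n ∧
    ∀ x : Sph q, f x = MvPolynomial.eval (fun i => (x : Euc q) i) P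

/-- `f` is a spherical harmonic of degree `ℓ` : the restriction to the sphere of a
homogeneous harmonic polynomial of degree `ℓ`. -/
def IsSphHarm (q ℓ : ℕ) (f : Sph q → ℝ) : Prop :=
  ∃ P : MvPolynomial (Fin (q + 1)) ℝ, P.IsHomogeneous ℓ ∧
    (∑ i : Fin (q + 1), MvPolynomial.pderiv i (MvPolynomial.pderiv i P)) = 0 ∧
    ∀ x : Sph q, f x = MvPolynomial.eval (fun i => (x : Euc q) i) P

/-- Rotation of a point of the sphere by a linear isometry of the ambient space. -/
def rotate {q : ℕ} (R : Euc q ≃ₗᵢ[ℝ] Euc q) (x : Sph q) : Sph q :=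
  ⟨R x, by
    have hx : ‖(x : Euc q)‖ = 1 := mem_sphere_zero_iff_norm.mp x.2
    simp [mem_sphere_zero_iff_norm, hx]⟩

/-- `μ` is invariant under all rotations of the sphere. -/
def RotInvariant (q : ℕ) (μ : Measure (Sph q)) : Prop :=
  ∀ R : Euc q ≃ₗᵢ[ℝ] Euc q, Measure.map (rotate R) μ = μ

/-- `IterIntBV S f` : `f` is an `S` times iterated integral of a function of bounded
variation (on `[0,∞)`). -/
def IterIntBV : ℕ → (ℝ → ℝ) → Prop
  | 0, f => BoundedVariationOn f (Set.Ici 0)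
  | (S + 1), f => ∃ g : ℝ → ℝ, IterIntBV S g ∧ ∀ x : ℝ, 0 ≤ x → f x = f 0 + ∫ t in (0 : ℝ)..x, g t

/-- The standing hypotheses on the filter function `h` : `h = 1` on `[0,1/2]`, `h = 0` on
`(1,∞)`, `h` nonincreasing on `[0,∞)`, and `h` an `S` times iterated integral of a function
of bounded variation. -/
def GoodH (S : ℕ) (h : ℝ → ℝ) : Prop :=
  (∀ x : ℝ, 0 ≤ x → x ≤ 1 / 2 → h x = 1) ∧
  (∀ x : ℝ, 1 < x → h x = 0) ∧
  (∀ x y : ℝ, 0 ≤ x → x ≤ y → h y ≤ h x) ∧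
  IterIntBV S h

/-- `Y ℓ ·` is, for each `ℓ`, an orthonormal basis of the space of degree `ℓ` spherical
harmonics in `L²(μ)`. -/
def GoodBasis (q : ℕ) (μ : Measure (Sph q)) (d : ℕ → ℕ)
    (Y : (ℓ : ℕ) → Fin (d ℓ) → Sph q → ℝ) : Prop :=
  (∀ ℓ k, IsSphHarm q ℓ (Y ℓ k)) ∧
  (∀ (ℓ ℓ' : ℕ) (k : Fin (d ℓ)) (k' : Fin (d ℓ')),
      ∫ x, Y ℓ k x * Y ℓ' k' x ∂μ = if ℓ = ℓ' ∧ (k : ℕ) = (k' : ℕ) then 1 else 0) ∧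
  (∀ (ℓ : ℕ) (f : Sph q → ℝ), IsSphHarm q ℓ f →
      ∃ a : Fin (d ℓ) → ℝ, ∀ x, f x = ∑ k, a k * Y ℓ k x)

/-- The kernel `Φ_n(h; x·ξ) = Σ_{ℓ=0}^n h(ℓ/n) Σ_k Y_{ℓ,k}(x) Y_{ℓ,k}(ξ)`. -/
def Phi {q : ℕ} (d : ℕ → ℕ) (Y : (ℓ : ℕ) → Fin (d ℓ) → Sph q → ℝ) (h : ℝ → ℝ) (n : ℕ)
    (x ξ : Sph q) : ℝ :=
  ∑ ℓ ∈ range (n + 1), h ((ℓ : ℝ) / (n : ℝ)) * ∑ k, Y ℓ k x * Y ℓ k ξ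

/-- The discretized operator `σ_n(C, W; h; Z, x) = Σ_{ξ∈C} w_ξ z_ξ Φ_n(h; x·ξ)`. -/
def sigmaOp {q : ℕ} (d : ℕ → ℕ) (Y : (ℓ : ℕ) → Fin (d ℓ) → Sph q → ℝ) (h : ℝ → ℝ) (n : ℕ)
    (C : Finset (Sph q)) (w : Sph q → ℝ) (z : Sph q → ℝ) (x : Sph q) : ℝ :=
  ∑ ξ ∈ C, w ξ * z ξ * Phi d Y h n x ξ

/-- The summability operator `σ*_n(h; f, x) = ∫ f(ζ) Φ_n(h; x·ζ) dμ(ζ)`. -/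
def sigmaStar {q : ℕ} (μ : Measure (Sph q)) (d : ℕ → ℕ)
    (Y : (ℓ : ℕ) → Fin (d ℓ) → Sph q → ℝ) (h : ℝ → ℝ) (n : ℕ) (f : Sph q → ℝ)
    (x : Sph q) : ℝ :=
  ∫ ζ, f ζ * Phi d Y h n x ζ ∂μ

/-- Sup norm on the sphere. -/
def supNorm {q : ℕ} (f : Sph q → ℝ) : ℝ := ⨆ x : Sph q, |f x|

/-- Sup norm on a subset of the sphere. -/
def supNormOn {q : ℕ} (K : Set (Sph q)) (f : Sph q → ℝ) : ℝ := ⨆ x ∈ K, |f x|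

/-- The spherical cap of radius `δ` centered at `x₀`. -/
def cap {q : ℕ} (x₀ : Sph q) (δ : ℝ) : Set (Sph q) := {x | gdist x x₀ ≤ δ}

/-- `C` admits a Marcinkiewicz–Zygmund quadrature of order `m` with weights `w` and
M–Z constant `c₀`. -/
def MZQuad (q : ℕ) (μ : Measure (Sph q)) (m : ℕ) (C : Finset (Sph q)) (w : Sph q → ℝ)
    (c₀ : ℝ) : Prop :=
  (∀ P : Sph q → ℝ, InPi q (2 * m) P → ∑ ξ ∈ C, w ξ * P ξ = ∫ x, P x ∂μ) ∧
  (∀ P : Sph q → ℝ, InPi q (2 * m) P → ∀ p : ℝ, 1 ≤ p →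
      (∑ ξ ∈ C, |w ξ| * |P ξ| ^ p) ^ (1 / p) ≤ c₀ * (∫ x, |P x| ^ p ∂μ) ^ (1 / p))

/-- The sequence `n ↦ 2^((n+1)r) ‖σ*_{2^(n+1)}(h;f) − σ*_{2^n}(h;f)‖_{∞,K}`. -/
def WrSeqOn {q : ℕ} (K : Set (Sph q)) (μ : Measure (Sph q)) (d : ℕ → ℕ)
    (Y : (ℓ : ℕ) → Fin (d ℓ) → Sph q → ℝ) (h : ℝ → ℝ) (r : ℝ) (f : Sph q → ℝ) (n : ℕ) : ℝ :=
  (2 : ℝ) ^ (((n : ℝ) + 1) * r) *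
    supNormOn K (fun x => sigmaStar μ d Y h (2 ^ (n + 1)) f x - sigmaStar μ d Y h (2 ^ n) f x)

/-- The norm `‖f‖_{W_r(K)}`. -/
def WrNormOn {q : ℕ} (K : Set (Sph q)) (μ : Measure (Sph q)) (d : ℕ → ℕ)
    (Y : (ℓ : ℕ) → Fin (d ℓ) → Sph q → ℝ) (h : ℝ → ℝ) (r : ℝ) (f : Sph q → ℝ) : ℝ :=
  supNorm f + ⨆ n : ℕ, WrSeqOn K μ d Y h r f n

/-- The norm `‖f‖_{W_r}`. -/
def WrNorm {q : ℕ} (μ : Measure (Sph q)) (d : ℕ → ℕ)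
    (Y : (ℓ : ℕ) → Fin (d ℓ) → Sph q → ℝ) (h : ℝ → ℝ) (r : ℝ) (f : Sph q → ℝ) : ℝ :=
  WrNormOn Set.univ μ d Y h r f

/-- Membership in `W_r(K)` : `f` is continuous and the `W_r(K)` seminorm is finite. -/
def MemWrOn {q : ℕ} (K : Set (Sph q)) (μ : Measure (Sph q)) (d : ℕ → ℕ)
    (Y : (ℓ : ℕ) → Fin (d ℓ) → Sph q → ℝ) (h : ℝ → ℝ) (r : ℝ) (f : Sph q → ℝ) : Prop :=
  Continuous f ∧ BddAbove (Set.range (WrSeqOn K μ d Y h r f))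

/-- `y` is an orthonormal basis of `Π_n^q` in `L²(μ)` (so `N = dim Π_n^q`), whose `0`-th
element is the constant polynomial `1`. -/
def GoodPolyBasis (q n N : ℕ) (μ : Measure (Sph q)) (y : Fin N → Sph q → ℝ) : Prop :=
  (∀ i, InPi q n (y i)) ∧
  (∀ i j, ∫ x, y i x * y j x ∂μ = if i = j then 1 else 0) ∧
  (∀ P : Sph q → ℝ, InPi q n P → ∃ a : Fin N → ℝ, ∀ x, P x = ∑ i, a i * y i x) ∧
  (∀ i : Fin N, (i : ℕ) = 0 → ∀ x, y i x = 1)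

/-- The Gram matrix `(G_N)_{i,j} = Σ_{ξ∈C} v_ξ y_i(ξ) y_j(ξ)`. -/
def gram {q N : ℕ} (C : Finset (Sph q)) (v : Sph q → ℝ) (y : Fin N → Sph q → ℝ) :
    Matrix (Fin N) (Fin N) ℝ :=
  Matrix.of fun i j => ∑ ξ ∈ C, v ξ * y i ξ * y j ξ

/-- The least squares quadrature weights `w_ξ^{LSQ} = v_ξ Σ_k (G_N⁻¹)_{i₀,k} y_k(ξ)`. -/
def wLSQ {q N : ℕ} (C : Finset (Sph q)) (v : Sph q → ℝ) (y : Fin N → Sph q → ℝ) (i0 : Fin N)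
    (ξ : Sph q) : ℝ :=
  v ξ * ∑ k, (gram C v y)⁻¹ i0 k * y k ξ

/-- Two–sided Marcinkiewicz–Zygmund inequalities for the masses `v` on `C`, for all
`1 ≤ p ≤ ∞`. -/
def VMZ (q n : ℕ) (μ : Measure (Sph q)) (C : Finset (Sph q)) (v : Sph q → ℝ)
    (c₁ c₂ : ℝ) : Prop :=
  (∀ P : Sph q → ℝ, InPi q n P → ∀ p : ℝ, 1 ≤ p →
      c₁ * (∫ x, |P x| ^ p ∂μ) ^ (1 / p) ≤ (∑ ξ ∈ C, v ξ * |P ξ| ^ p) ^ (1 / p) ∧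
      (∑ ξ ∈ C, v ξ * |P ξ| ^ p) ^ (1 / p) ≤ c₂ * (∫ x, |P x| ^ p ∂μ) ^ (1 / p)) ∧
  (∀ P : Sph q → ℝ, InPi q n P →
      c₁ * supNorm P ≤ (⨆ ξ ∈ (C : Set (Sph q)), |P ξ|) ∧
      (⨆ ξ ∈ (C : Set (Sph q)), |P ξ|) ≤ c₂ * supNorm P)


/-- Polynomials in `q+1` real variables. -/
abbrev MvP (q : ℕ) := MvPolynomial (Fin (q + 1)) ℝ

/-- Evaluation of a polynomial at a point of `ℝ^(q+1)`. -/
def evalAt {q : ℕ} (x : Fin (q + 1) → ℝ) (P : MvP q) : ℝ := MvPolynomial.eval x P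

/-- `P` is a monomial (with coefficient `1`). -/
def IsMonomial {q : ℕ} (P : MvP q) : Prop :=
  ∃ m : (Fin (q + 1)) →₀ ℕ, P = MvPolynomial.monomial m 1

/-- `D_k`, the total degree of the `k`-th monomial in the enumeration `u`. -/
def Dg {q : ℕ} (u : ℕ → MvP q) (k : ℕ) : ℕ := (u k).totalDegree

/-- `u` is a degree–ordered enumeration of all monomials in `q+1` variables, starting with
`u 0 ≡ 1`, whose restrictions to the support of `μ` are linearly independent in `L²(μ)`. -/
def GoodEnum (q : ℕ) (μ : Measure (Fin (q + 1) → ℝ)) (u : ℕ → MvP q) : Prop :=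
  u 0 = 1 ∧ (∀ k, IsMonomial (u k)) ∧ Function.Injective u ∧
  (∀ m : (Fin (q + 1)) →₀ ℕ, ∃ k, u k = MvPolynomial.monomial m 1) ∧
  (∀ j k : ℕ, j ≤ k → Dg u j ≤ Dg u k) ∧
  (∀ (K : ℕ) (c : ℕ → ℝ),
    (∀ᵐ x ∂μ, ∑ j ∈ range (K + 1), c j * evalAt x (u j) = 0) → ∀ j ≤ K, c j = 0)

/-- `y` is the Gram–Schmidt orthonormalization of the sequence `u` in `L²(μ)` :
`y k ∈ V_k = span{u 0,…,u k}`, the `y`'s are orthonormal, and the orientation is fixed. -/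
def GramSchmidtOf (q : ℕ) (μ : Measure (Fin (q + 1) → ℝ)) (u y : ℕ → MvP q) : Prop :=
  (∀ k, y k ∈ Submodule.span ℝ (u '' Set.Iic k)) ∧
  (∀ j k : ℕ, (∫ x, evalAt x (y j) * evalAt x (y k) ∂μ) = if j = k then 1 else 0) ∧
  (∀ k, 0 ≤ ∫ x, evalAt x (y k) * evalAt x (u k) ∂μ)

/-- `t 0, …, t (N−1)` is the Gram–Schmidt orthonormalization of `u` in `L²(ν)`,
carried out up to index `N − 1`. -/
def GramSchmidtUpTo (q N : ℕ) (ν : Measure (Fin (q + 1) → ℝ)) (u t : ℕ → MvP q) : Prop :=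
  (∀ k < N, t k ∈ Submodule.span ℝ (u '' Set.Iic k)) ∧
  (∀ j < N, ∀ k < N, (∫ x, evalAt x (t j) * evalAt x (t k) ∂ν) = if j = k then 1 else 0) ∧
  (∀ k < N, 0 ≤ ∫ x, evalAt x (t k) * evalAt x (u k) ∂ν)

/-- All polynomial moments of `μ` are finite. -/
def PolyMomentsFinite (q : ℕ) (μ : Measure (Fin (q + 1) → ℝ)) : Prop :=
  ∀ P : MvP q, Integrable (fun x => evalAt x P) μ

/-- `p k` is the minimal index such that some monomial `ft k` of degree `1` satisfies
`ft k * u (p k) = u (k+1)`. -/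
def GoodStep (q : ℕ) (u : ℕ → MvP q) (p : ℕ → ℕ) (ft : ℕ → MvP q) : Prop :=
  ∀ k : ℕ, IsMonomial (ft k) ∧ (ft k).totalDegree = 1 ∧ ft k * u (p k) = u (k + 1) ∧
    ∀ j < p k, ¬∃ g : MvP q, IsMonomial g ∧ g.totalDegree = 1 ∧ g * u j = u (k + 1)

/-- The moment functional `P ↦ ∫ P dμ` on polynomials. -/
def momentFunctional {q : ℕ} {μ : Measure (Fin (q + 1) → ℝ)} (hmom : PolyMomentsFinite q μ) :
    MvP q →ₗ[ℝ] ℝ where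
  toFun P := ∫ x, evalAt x P ∂μ
  map_add' P Q := by
    simpa [evalAt] using integral_add (hmom P) (hmom Q)
  map_smul' c P := by
    simp [evalAt, MvPolynomial.smul_eval, integral_const_mul]

theorem momentFunctional_mul {q : ℕ} {μ : Measure (Fin (q + 1) → ℝ)}
    (hmom : PolyMomentsFinite q μ) (P Q : MvP q) :
    momentFunctional hmom (P * Q) = ∫ x, evalAt x P * evalAt x Q ∂μ := by
  simp [momentFunctional, evalAt]

theorem GramSchmidtOf.moment_mul {q : ℕ} {μ : Measure (Fin (q + 1) → ℝ)}
    (hmom : PolyMomentsFinite q μ) {u y : ℕ → MvP q} (hy : GramSchmidtOf q μ u y) (j k : ℕ) :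
    momentFunctional hmom (y j * y k) = if j = k then 1 else 0 := by
  rw [momentFunctional_mul, hy.2.1]

theorem GramSchmidtOf.moment_mul_eq_zero {q : ℕ} {μ : Measure (Fin (q + 1) → ℝ)}
    (hmom : PolyMomentsFinite q μ) {u y : ℕ → MvP q} (hy : GramSchmidtOf q μ u y) {k : ℕ}
    {P : MvP q} (hP : P ∈ Submodule.span ℝ (y '' Set.Iio k)) :
    momentFunctional hmom (P * y k) = 0 := by
  induction hP using Submodule.span_induction with
  | mem x hx =>
    obtain ⟨j, hj, rfl⟩ := hx
    rw [hy.moment_mul, if_neg (ne_of_lt hj)]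
  | zero => simp
  | add x z _ _ hx hz => rw [add_mul, map_add, hx, hz, add_zero]
  | smul c x _ hx => rw [smul_mul_assoc, map_smul, hx, smul_zero]

theorem GramSchmidtOf.span_le {q : ℕ} {μ : Measure (Fin (q + 1) → ℝ)}
    (hmom : PolyMomentsFinite q μ) {u y : ℕ → MvP q} (hy : GramSchmidtOf q μ u y) (n : ℕ) :
    Submodule.span ℝ (u '' Set.Iio n) ≤ Submodule.span ℝ (y '' Set.Iio n) := by
  induction n with
  | zero => simp
  | succ n ih =>
    have hmono : Submodule.span ℝ (y '' Set.Iio n) ≤ Submodule.span ℝ (y '' Set.Iio (n + 1)) :=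
      Submodule.span_mono (Set.image_mono (Set.Iio_subset_Iio n.le_succ))
    have hyn : y n ∈ Submodule.span ℝ (y '' Set.Iio (n + 1)) :=
      Submodule.subset_span ⟨n, Nat.lt_succ_self n, rfl⟩
    have hmem := hy.1 n
    rw [← Set.Iio_insert, Set.image_insert_eq, Submodule.mem_span_insert] at hmem
    obtain ⟨c, z, hz, hyz⟩ := hmem
    have hc : c ≠ 0 := by
      rintro rfl
      rw [zero_smul, zero_add] at hyz
      have h0 := hy.moment_mul_eq_zero hmom (k := n) (P := y n) (hyz ▸ ih hz)
      rw [hy.moment_mul, if_pos rfl] at h0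
      exact one_ne_zero h0
    rw [Submodule.span_le]
    rintro _ ⟨j, hj, rfl⟩
    rcases Nat.lt_succ_iff_lt_or_eq.mp hj with hjn | rfl
    · exact hmono (ih (Submodule.subset_span ⟨j, hjn, rfl⟩))
    · have huj : u j = c⁻¹ • (y j - z) := by
        rw [hyz, add_sub_cancel_right, inv_smul_smul₀ hc]
      rw [huj]
      exact Submodule.smul_mem _ _ (Submodule.sub_mem _ hyn (hmono (ih hz)))

theorem GramSchmidtOf.eq_sum {q : ℕ} {μ : Measure (Fin (q + 1) → ℝ)}
    (hmom : PolyMomentsFinite q μ) {u y : ℕ → MvP q} (hy : GramSchmidtOf q μ u y) {n : ℕ}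
    {P : MvP q} (hP : P ∈ Submodule.span ℝ (u '' Set.Iio n)) :
    P = ∑ m ∈ range n, momentFunctional hmom (P * y m) • y m := by
  have hP' := hy.span_le hmom n hP
  clear hP
  induction hP' using Submodule.span_induction with
  | mem x hx =>
    obtain ⟨j, hj, rfl⟩ := hx
    simp [hy.moment_mul hmom, Set.mem_Iio.mp hj]
  | zero => simp
  | add x z _ _ hx hz =>
    simp only [add_mul, map_add, add_smul, sum_add_distrib]
    rw [← hx, ← hz]
  | smul c x _ hx =>
    simp only [smul_mul_assoc, map_smul, smul_assoc, ← smul_sum]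
    rw [← hx]

theorem GoodEnum.mem_span {q : ℕ} {μ : Measure (Fin (q + 1) → ℝ)} {u : ℕ → MvP q}
    (hu : GoodEnum q μ u) {s : Set ℕ} {P : MvP q}
    (hs : ∀ m, Dg u m ≤ P.totalDegree → m ∈ s) : P ∈ Submodule.span ℝ (u '' s) := by
  rw [P.as_sum]
  refine Submodule.sum_mem _ fun v hv => ?_
  obtain ⟨k, hk⟩ := hu.2.2.2.1 v
  have hmon : MvPolynomial.monomial v (P.coeff v) = P.coeff v • u k := by
    rw [hk, MvPolynomial.smul_monomial, smul_eq_mul, mul_one]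
  rw [hmon]
  refine Submodule.smul_mem _ _ (Submodule.subset_span ⟨k, hs k ?_, rfl⟩)
  rw [Dg, hk, MvPolynomial.totalDegree_monomial _ one_ne_zero]
  exact MvPolynomial.le_totalDegree hv

theorem GoodEnum.totalDegree_le {q : ℕ} {μ : Measure (Fin (q + 1) → ℝ)} {u : ℕ → MvP q}
    (hu : GoodEnum q μ u) {k : ℕ} {P : MvP q} (hP : P ∈ Submodule.span ℝ (u '' Set.Iic k)) :
    P.totalDegree ≤ Dg u k := by
  induction hP using Submodule.span_induction with
  | mem x hx =>
    obtain ⟨j, hj, rfl⟩ := hx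
    exact hu.2.2.2.2.1 j k hj
  | zero => simp
  | add x z _ _ hx hz => exact (MvPolynomial.totalDegree_add x z).trans (max_le hx hz)
  | smul c x _ hx => exact (MvPolynomial.totalDegree_smul_le c x).trans hx

theorem GoodEnum.exists_bound {q : ℕ} {μ : Measure (Fin (q + 1) → ℝ)} {u : ℕ → MvP q}
    (hu : GoodEnum q μ u) (d : ℕ) : ∃ M : ℕ, ∀ m : ℕ, Dg u m ≤ d → m ≤ M := by
  have hfin : {m : ℕ | Dg u m ≤ d}.Finite := by
    refine Set.Finite.of_finite_image (f := u) (((Finsupp.finite_of_degree_le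
      (σ := Fin (q + 1)) d).image fun v => MvPolynomial.monomial v (1 : ℝ)).subset ?_)
      hu.2.2.1.injOn
    rintro _ ⟨m, hm, rfl⟩
    obtain ⟨v, hv⟩ := hu.2.1 m
    refine ⟨v, ?_, hv.symm⟩
    rwa [Set.mem_ofPred_eq, Dg, hv, MvPolynomial.totalDegree_monomial _ one_ne_zero] at hm
  obtain ⟨M, hM⟩ := hfin.bddAbove
  exact ⟨M, fun m hm => hM hm⟩

theorem GramSchmidtOf.moment_mul_eq_zero_of_totalDegree_lt {q : ℕ}
    {μ : Measure (Fin (q + 1) → ℝ)} (hmom : PolyMomentsFinite q μ) {u y : ℕ → MvP q}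
    (hu : GoodEnum q μ u) (hy : GramSchmidtOf q μ u y) {k : ℕ} {P : MvP q}
    (hP : P.totalDegree < Dg u k) : momentFunctional hmom (P * y k) = 0 := by
  refine hy.moment_mul_eq_zero hmom (hy.span_le hmom k (hu.mem_span fun m hm => ?_))
  by_contra hkm
  exact absurd (hu.2.2.2.2.1 k m (not_lt.mp hkm)) (by omega)

/-- Multiplication of `y ℓ` by a polynomial of degree at most `1` only involves the `y m` whose
degrees differ from that of `y ℓ` by at most `1`. -/
theorem GramSchmidtOf.mul_eq_sum_filter {q : ℕ}
    {μ : Measure (Fin (q + 1) → ℝ)} (hmom : PolyMomentsFinite q μ) {u y : ℕ → MvP q}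
    (hu : GoodEnum q μ u) (hy : GramSchmidtOf q μ u y) {f : MvP q} (hf : f.totalDegree ≤ 1)
    {ℓ M : ℕ} (hM : ∀ m : ℕ, Dg u m ≤ Dg u ℓ + 1 → m ≤ M) :
    f * y ℓ = ∑ m ∈ (range (M + 1)).filter (fun m => Dg u ℓ ≤ Dg u m + 1 ∧ Dg u m ≤ Dg u ℓ + 1),
      momentFunctional hmom (f * y ℓ * y m) • y m := by
  have hdeg (i : ℕ) : (f * y i).totalDegree ≤ Dg u i + 1 := by
    have h1 := MvPolynomial.totalDegree_mul f (y i)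
    have h2 := hu.totalDegree_le (hy.1 i)
    omega
  have hspan : f * y ℓ ∈ Submodule.span ℝ (u '' Set.Iio (M + 1)) :=
    hu.mem_span fun m hm => Nat.lt_succ_of_le (hM m (hm.trans (hdeg ℓ)))
  rw [sum_filter_of_ne]
  · exact hy.eq_sum hmom hspan
  · intro m _ hne
    by_contra hcon
    refine hne ?_
    have h0 : momentFunctional hmom (f * y ℓ * y m) = 0 := by
      by_cases hm : Dg u m ≤ Dg u ℓ + 1
      · rw [mul_right_comm]
        refine hy.moment_mul_eq_zero_of_totalDegree_lt hmom hu ?_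
        have := hdeg m
        omega
      · refine hy.moment_mul_eq_zero_of_totalDegree_lt hmom hu ?_
        have := hdeg ℓ
        omega
    rw [h0, zero_smul]

/-- The connection-coefficient recurrence
`A_k c_{k+1,ℓ} = Σ_m r_{ℓ,m}(f_k) c_{p(k),m} + Σ_j s_{k,j} c_{j,ℓ}`
for `c_{k,j} = ∫ t_k y_j dμ`. -/
theorem statement15 (q : ℕ) (Ω : Set (Fin (q + 1) → ℝ))
    (μ : Measure (Fin (q + 1) → ℝ)) (hμ : IsProbabilityMeasure μ) (hμΩ : μ Ωᶜ = 0)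
    (hmom : PolyMomentsFinite q μ)
    (u : ℕ → MvP q) (hu : GoodEnum q μ u)
    (y : ℕ → MvP q) (hy : GramSchmidtOf q μ u y)
    (ν : Measure (Fin (q + 1) → ℝ)) (hν : ν Ωᶜ = 0) (hmomν : PolyMomentsFinite q ν)
    (p : ℕ → ℕ) (ft : ℕ → MvP q) (hp : GoodStep q u p ft)
    (N : ℕ) (hN : 1 ≤ N)
    (hGram : (Matrix.of fun ℓ k : Fin N =>
        ∫ x, evalAt x (y ℓ) * evalAt x (y k) ∂ν).PosDef)
    (t : ℕ → MvP q) (ht : GramSchmidtUpTo q N ν u t) :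
    ∀ k ℓ : ℕ, k + 1 < N → ℓ < N →
      ∀ (f : MvP q) (a A : ℝ) (s : ℕ → ℝ),
        a ≠ 0 → f = a • ft k → 0 ≤ A →
        f * t (p k) = A • t (k + 1) - ∑ j ∈ range (k + 1), s j • t j →
        (∀ j ≤ k, s j ≠ 0 → Dg u (k + 1) ≤ Dg u j + 2 ∧ Dg u j ≤ Dg u k) →
        ∃ Mx : ℕ, (∀ m : ℕ, Dg u m ≤ Dg u ℓ + 1 → m ≤ Mx) ∧
          A * (∫ x, evalAt x (t (k + 1)) * evalAt x (y ℓ) ∂μ) =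
            (∑ m ∈ (range (Mx + 1)).filter
                (fun m => Dg u ℓ ≤ Dg u m + 1 ∧ Dg u m ≤ Dg u ℓ + 1),
              (∫ x, evalAt x f * evalAt x (y ℓ) * evalAt x (y m) ∂μ) *
                ∫ x, evalAt x (t (p k)) * evalAt x (y m) ∂μ) +
            ∑ j ∈ (range (k + 1)).filter
                (fun j => Dg u (k + 1) ≤ Dg u j + 2 ∧ Dg u j ≤ Dg u k),
              s j * ∫ x, evalAt x (t j) * evalAt x (y ℓ) ∂μ := by
  intro k ℓ _ _ f a A s _ hfa _ hrec hs
  have hf : f.totalDegree ≤ 1 := by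
    rw [hfa]
    exact (MvPolynomial.totalDegree_smul_le _ _).trans (hp k).2.1.le
  obtain ⟨M, hM⟩ := hu.exists_bound (Dg u ℓ + 1)
  refine ⟨M, hM, ?_⟩
  have hr (m : ℕ) : ∫ x, evalAt x f * evalAt x (y ℓ) * evalAt x (y m) ∂μ
      = momentFunctional hmom (f * y ℓ * y m) := by
    simp [momentFunctional, evalAt]
  simp only [hr, ← momentFunctional_mul hmom]
  have hfilter : ∑ j ∈ (range (k + 1)).filter
        (fun j => Dg u (k + 1) ≤ Dg u j + 2 ∧ Dg u j ≤ Dg u k),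
        s j * momentFunctional hmom (t j * y ℓ)
      = ∑ j ∈ range (k + 1), s j * momentFunctional hmom (t j * y ℓ) :=
    sum_filter_of_ne fun j hj hne =>
      hs j (Nat.lt_succ_iff.mp (mem_range.mp hj)) (left_ne_zero_of_mul hne)
  have hexp : momentFunctional hmom (t (p k) * (f * y ℓ)) =
      ∑ m ∈ (range (M + 1)).filter (fun m => Dg u ℓ ≤ Dg u m + 1 ∧ Dg u m ≤ Dg u ℓ + 1),
        momentFunctional hmom (f * y ℓ * y m) * momentFunctional hmom (t (p k) * y m) := by
    conv_lhs => rw [hy.mul_eq_sum_filter hmom hu hf hM]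
    simp only [mul_sum, map_sum, mul_smul_comm, map_smul, smul_eq_mul]
  have hA : A • t (k + 1) * y ℓ = t (p k) * (f * y ℓ) + ∑ j ∈ range (k + 1), s j • (t j * y ℓ) := by
    rw [← sub_add_cancel (A • t (k + 1)) (∑ j ∈ range (k + 1), s j • t j), ← hrec, add_mul, sum_mul]
    simp only [smul_mul_assoc]
    ring
  rw [hfilter, ← hexp, ← smul_eq_mul, ← map_smul, ← smul_mul_assoc, hA, map_add, map_sum]
  simp only [map_smul, smul_eq_mul]

end SD
end
end

section
/- Let n ≥ 1 be an integer, C ⊂ S^q a finite set, and (v_ξ)_{ξ∈C} positive numbers satisfying the lower Marcinkiewicz–Zygmund inequality ∫_{S^q} |P| dμ_q ≤ c₁ Σ_{ξ∈C} v_ξ |P(ξ)| for all P ∈ Π_n^q. Then there exist real numbers (W_ξ)_{ξ∈C} such that |W_ξ| ≤ c₁ v_ξ for every ξ ∈ C and Σ_{ξ∈C} W_ξ P(ξ) = ∫_{S^q} P dμ_q for every P ∈ Π_n^q. -/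
noncomputable section

open MeasureTheory Finset

namespace SD

/-- Hahn–Banach for a functional dominated by a sublinear function of a linear map: it factors
through the linear map by a functional with the same domination. -/
theorem exists_comp_eq_of_le_sublinear {V E : Type*} [AddCommGroup V] [Module ℝ V]
    [AddCommGroup E] [Module ℝ E] (L : V →ₗ[ℝ] E) (I : V →ₗ[ℝ] ℝ) (N : E → ℝ)
    (N_hom : ∀ c : ℝ, 0 < c → ∀ x, N (c • x) = c * N x)
    (N_add : ∀ x y, N (x + y) ≤ N x + N y) (hI : ∀ x, I x ≤ N (L x)) :
    ∃ g : E →ₗ[ℝ] ℝ, (∀ x, g (L x) = I x) ∧ ∀ z, g z ≤ N z := by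
  have N_zero : N 0 = 0 := by
    have h := N_hom 2 two_pos 0
    rw [smul_zero] at h
    linarith
  have hker : I ∈ (LinearMap.ker L).dualAnnihilator := by
    rw [Submodule.mem_dualAnnihilator]
    intro x hx
    rw [LinearMap.mem_ker] at hx
    have h₁ := hI x
    have h₂ := hI (-x)
    rw [map_neg, map_neg, hx, neg_zero, N_zero] at h₂
    rw [hx, N_zero] at h₁
    linarith
  rw [← LinearMap.range_dualMap_eq_dualAnnihilator_ker] at hker
  obtain ⟨φ, rfl⟩ := hker
  obtain ⟨g, hg, hgN⟩ := exists_extension_of_le_sublinear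
    ⟨LinearMap.range L, φ.domRestrict (LinearMap.range L)⟩ N N_hom N_add (by
      rintro ⟨_, x, rfl⟩
      exact hI x)
  exact ⟨g, fun x => hg ⟨L x, x, rfl⟩, hgN⟩

/-- A functional on `V` dominated by a weighted `ℓ¹` norm of finitely many linear functionals is a
combination of them with coefficients bounded by the weights. -/
theorem exists_coeff_of_le_sum_abs {V ι : Type*} [AddCommGroup V] [Module ℝ V] [Fintype ι]
    (L : V →ₗ[ℝ] ι → ℝ) (I : V →ₗ[ℝ] ℝ) (w : ι → ℝ) (hw : ∀ i, 0 ≤ w i)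
    (hI : ∀ x, I x ≤ ∑ i, w i * |L x i|) :
    ∃ W : ι → ℝ, (∀ i, |W i| ≤ w i) ∧ ∀ x, ∑ i, W i * L x i = I x := by
  classical
  obtain ⟨g, hgI, hgN⟩ := exists_comp_eq_of_le_sublinear L I (fun z => ∑ i, w i * |z i|)
    (fun c hc z => by
      simp only [Pi.smul_apply, smul_eq_mul, abs_mul, abs_of_pos hc, Finset.mul_sum]
      exact Finset.sum_congr rfl fun i _ => by ring)
    (fun y z => by
      rw [← Finset.sum_add_distrib]
      refine Finset.sum_le_sum fun i _ => ?_
      rw [← mul_add]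
      exact mul_le_mul_of_nonneg_left (abs_add_le _ _) (hw i))
    hI
  have hsingle (i : ι) (t : ℝ) : ∑ j, w j * |(Pi.single i t : ι → ℝ) j| = w i * |t| := by
    rw [Finset.sum_eq_single i (fun j _ hj => by simp [hj]) (by simp), Pi.single_eq_same]
  refine ⟨fun i => g (Pi.single i 1), fun i => abs_le'.2 ⟨?_, ?_⟩, fun x => ?_⟩
  · simpa [hsingle] using hgN (Pi.single i 1)
  · rw [← map_neg, ← Pi.single_neg]
    simpa [hsingle] using hgN (Pi.single i (-1))
  · rw [← hgI, LinearMap.pi_apply_eq_sum_univ g (L x)]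
    refine Finset.sum_congr rfl fun i _ => ?_
    have h : (Pi.single i 1 : ι → ℝ) = fun j => if i = j then 1 else 0 := by
      ext j
      simp [Pi.single_apply, eq_comm]
    simp only [h, smul_eq_mul, mul_comm]

/-- Polynomials are integrable on the sphere. -/
theorem integrable_eval {q : ℕ} (μ : Measure (Sph q)) [IsFiniteMeasure μ]
    (P : MvPolynomial (Fin (q + 1)) ℝ) :
    Integrable (fun x : Sph q => MvPolynomial.eval (fun i => (x : Euc q) i) P) μ := by
  have hcont : Continuous fun x : Sph q => MvPolynomial.eval (fun i => (x : Euc q) i) P :=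
    (MvPolynomial.continuous_eval P).comp (by fun_prop)
  exact hcont.integrable_of_hasCompactSupport (HasCompactSupport.of_compactSpace _)

/-- From the lower M–Z inequality one obtains exact quadrature weights `W_ξ` with
`|W_ξ| ≤ c₁ v_ξ`. -/
theorem statement17 (q : ℕ) (hq : 1 ≤ q)
    (μ : Measure (Sph q)) (hμ : IsProbabilityMeasure μ) (hrot : RotInvariant q μ)
    (n : ℕ) (hn : 1 ≤ n) (C : Finset (Sph q)) (v : Sph q → ℝ) (hv : ∀ ξ ∈ C, 0 < v ξ)
    (c₁ : ℝ) (hc₁ : 0 < c₁)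
    (hlow : ∀ P : Sph q → ℝ, InPi q n P →
      (∫ x, |P x| ∂μ) ≤ c₁ * ∑ ξ ∈ C, v ξ * |P ξ|) :
    ∃ W : Sph q → ℝ, (∀ ξ ∈ C, |W ξ| ≤ c₁ * v ξ) ∧
      ∀ P : Sph q → ℝ, InPi q n P → (∑ ξ ∈ C, W ξ * P ξ) = ∫ x, P x ∂μ := by
  classical
  let V := MvPolynomial.restrictTotalDegree (Fin (q + 1)) ℝ n
  let L : V →ₗ[ℝ] C → ℝ :=
    { toFun := fun P ξ => MvPolynomial.eval (fun i => (ξ.1 : Euc q) i) P.1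
      map_add' := fun P Q => by ext; simp
      map_smul' := fun c P => by ext; simp }
  let I : V →ₗ[ℝ] ℝ :=
    { toFun := fun P => ∫ x : Sph q, MvPolynomial.eval (fun i => (x : Euc q) i) P.1 ∂μ
      map_add' := fun P Q => by
        simp [integral_add (integrable_eval μ P.1) (integrable_eval μ Q.1)]
      map_smul' := fun c P => by simp [integral_const_mul] }
  obtain ⟨W, hW, hWI⟩ := exists_coeff_of_le_sum_abs L I (fun ξ => c₁ * v ξ)
    (fun ξ => (mul_pos hc₁ (hv ξ ξ.2)).le) (fun P => by
      refine (le_abs_self _).trans (abs_integral_le_integral_abs.trans ?_)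
      refine (hlow _ ⟨P.1, (MvPolynomial.mem_restrictTotalDegree _ _ _).1 P.2,
        fun _ => rfl⟩).trans_eq ?_
      rw [← Finset.sum_coe_sort, Finset.mul_sum]
      exact Finset.sum_congr rfl fun ξ _ => (mul_assoc _ _ _).symm)
  refine ⟨fun ξ => if h : ξ ∈ C then W ⟨ξ, h⟩ else 0, fun ξ hξ => ?_, ?_⟩
  · simpa [hξ] using hW ⟨ξ, hξ⟩
  · rintro f ⟨P, hP, hf⟩
    obtain rfl : f = _ := funext hf
    rw [← Finset.sum_coe_sort]
    simpa [L, I] using hWI ⟨P, (MvPolynomial.mem_restrictTotalDegree _ _ _).2 hP⟩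

end SD
end
end
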